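/- Let (ξ_n), (η_n), (λ_n) for n ≤ N with λ_n real and linearly independent over ℚ, ξ_n > 0, η_n real. Then for all T₁ < T₂ and every positive integer M, inf_{t ∈ [T₁,T₂]} ∑_{n≤N} ξ_n ‖λ_n t - η_n‖² ≤ (1/4) ∑_{n≤N} ξ_n ( sin²(π/(2(M+1))) + M^N/(π (T₂-T₁) Λ) ), where ‖x‖ denotes the distance from x to the nearest integer and Λ := min{ |∑_{n≤N} u_n λ_n| : u_n ∈ ℤ, |u_n| ≤ M, ∑ u_n λ_n ≠ 0 }. -/

import Mathlib

open Real

namespace ChenAux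

lemma osc (ω φ T₁ T₂ : ℝ) (hω : ω ≠ 0) :
    ‖∫ t in T₁..T₂, Complex.exp ((2 * π * (ω * t - φ) : ℝ) * Complex.I)‖ ≤ 1 / (π * |ω|) := by
  have hc : (2 * π * ω : ℝ) * Complex.I ≠ 0 := by
    have : (2 * π * ω : ℝ) ≠ 0 := by positivity
    exact mul_ne_zero (by exact_mod_cast this) Complex.I_ne_zero
  have h1 : ∀ t : ℝ, Complex.exp ((2 * π * (ω * t - φ) : ℝ) * Complex.I) =
      Complex.exp ((-(2 * π * φ) : ℝ) * Complex.I) *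
        Complex.exp (((2 * π * ω : ℝ) * Complex.I) * t) := by
    intro t
    rw [← Complex.exp_add]
    congr 1
    push_cast
    ring
  simp_rw [h1]
  rw [intervalIntegral.integral_const_mul, integral_exp_mul_complex hc, norm_mul,
    Complex.norm_exp_ofReal_mul_I, one_mul, norm_div]
  have h2 : ‖(2 * π * ω : ℝ) * Complex.I‖ = 2 * (π * |ω|) := by
    rw [norm_mul, Complex.norm_I, Complex.norm_real, Real.norm_eq_abs, abs_mul, abs_mul,
      abs_of_pos Real.pi_pos]
    norm_num
    ring
  have h3 : ∀ t : ℝ, ‖Complex.exp (((2 * π * ω : ℝ) * Complex.I) * t)‖ = 1 := by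
    intro t
    have : ((2 * π * ω : ℝ) * Complex.I) * t = ((2 * π * ω * t : ℝ) : ℂ) * Complex.I := by
      push_cast; ring
    rw [this, Complex.norm_exp_ofReal_mul_I]
  rw [h2]
  have h4 : ‖Complex.exp (((2 * π * ω : ℝ) * Complex.I) * T₂) -
      Complex.exp (((2 * π * ω : ℝ) * Complex.I) * T₁)‖ ≤ 2 := by
    refine (norm_sub_le _ _).trans ?_
    rw [h3, h3]; norm_num
  have h5 : 0 < π * |ω| := by positivity
  rw [div_le_div_iff₀ (by positivity) h5]
  nlinarith

/-- `e(x)` -/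
noncomputable def ee (x : ℝ) : ℂ := Complex.exp ((2 * π * x : ℝ) * Complex.I)

lemma ee_zpow (x : ℝ) (j : ℤ) : ee x ^ j = ee (j * x) := by
  unfold ee
  rw [← Complex.exp_int_mul]
  congr 1
  push_cast
  ring

lemma ee_ne (x : ℝ) : ee x ≠ 0 := Complex.exp_ne_zero _

lemma ee_cont : Continuous ee := by unfold ee; fun_prop

lemma main_int (N : ℕ) (lam η : Fin N → ℝ) (T₁ T₂ : ℝ) (M : ℕ) (L : ℝ) (hL : 0 < L)
    (hmin : ∀ u : Fin N → ℤ, (∀ n, |u n| ≤ (M : ℤ)) → u ≠ 0 → L ≤ |∑ n, (u n : ℝ) * lam n|)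
    (c : Fin N → ℤ → ℝ) (hc : ∀ n j, 0 ≤ c n j) :
    ‖(∫ t in T₁..T₂, ∏ n, ∑ j ∈ Finset.Icc (-(M:ℤ)) M, (c n j : ℂ) * ee (lam n * t - η n) ^ j)
      - ((T₂ - T₁) * ∏ n, c n 0 : ℝ)‖ ≤
      (∏ n, (∑ j ∈ Finset.Icc (-(M:ℤ)) M, c n j) - ∏ n, c n 0) / (π * L) := by
  classical
  set S := Fintype.piFinset (fun _ : Fin N => Finset.Icc (-(M:ℤ)) M) with hS
  have h0 : (0 : Fin N → ℤ) ∈ S := by simp [hS]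
  have e1 : ∀ t : ℝ, ∏ n, ∑ j ∈ Finset.Icc (-(M:ℤ)) M, (c n j : ℂ) * ee (lam n * t - η n) ^ j
      = ∑ u ∈ S, ((∏ n, c n (u n) : ℝ) : ℂ) *
        Complex.exp ((2 * π * ((∑ n, (u n : ℝ) * lam n) * t - ∑ n, (u n : ℝ) * η n) : ℝ)
          * Complex.I) := by
    intro t
    rw [Finset.prod_univ_sum]
    refine Finset.sum_congr rfl fun u _ => ?_
    rw [Finset.prod_mul_distrib]
    congr 1
    · push_cast; rfl
    · simp_rw [ee_zpow]
      unfold ee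
      rw [← Complex.exp_sum, ← Finset.sum_mul, ← Complex.ofReal_sum, ← Finset.mul_sum,
        Finset.sum_mul, ← Finset.sum_sub_distrib]
      congr 4
      exact Finset.sum_congr rfl fun n _ => by ring
  have e2 : ∏ n, (∑ j ∈ Finset.Icc (-(M:ℤ)) M, c n j) = ∑ u ∈ S, ∏ n, c n (u n) := by
    rw [Finset.prod_univ_sum]
  simp_rw [e1]
  rw [intervalIntegral.integral_finsetSum
    (fun u _ => Continuous.intervalIntegrable (by fun_prop) _ _), e2,
    ← Finset.add_sum_erase _ _ h0, ← Finset.add_sum_erase S (fun u => ∏ n, c n (u n)) h0]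
  simp only [intervalIntegral.integral_const_mul]
  have e3 : (((∏ n, c n ((0 : Fin N → ℤ) n) : ℝ) : ℂ) * ∫ t in T₁..T₂,
      Complex.exp ((2 * π * ((∑ n, (((0 : Fin N → ℤ) n : ℤ) : ℝ) * lam n) * t
        - ∑ n, (((0 : Fin N → ℤ) n : ℤ) : ℝ) * η n) : ℝ) * Complex.I))
      = ((T₂ - T₁) * ∏ n, c n 0 : ℝ) := by
    simp
    ring
  rw [e3, add_sub_cancel_left]
  have e4 : (∏ n, c n ((0 : Fin N → ℤ) n)) = ∏ n, c n 0 := rfl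
  rw [e4, add_sub_cancel_left, Finset.sum_div]
  refine (norm_sum_le _ _).trans (Finset.sum_le_sum fun u hu => ?_)
  rw [Finset.mem_erase] at hu
  have hu2 : ∀ n, |u n| ≤ (M:ℤ) := by
    intro n
    have := Fintype.mem_piFinset.1 hu.2 n
    rw [Finset.mem_Icc] at this
    exact abs_le.2 this
  have hl := hmin u hu2 hu.1
  have hp : 0 ≤ ∏ n, c n (u n) := Finset.prod_nonneg fun n _ => hc n _
  rw [norm_mul, Complex.norm_real, Real.norm_of_nonneg hp, div_eq_mul_one_div]
  refine mul_le_mul_of_nonneg_left ?_ hp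
  refine (osc _ _ _ _ (abs_pos.1 (hL.trans_le hl))).trans ?_
  have := Real.pi_pos
  gcongr

/-- shift lemma -/
lemma shift (f : ℤ → ℂ) (p q A B r : ℤ) (hf : ∀ m, f m ≠ 0 → p ≤ m ∧ m ≤ q)
    (h1 : A + r ≤ p) (h2 : q ≤ B + r) (z : ℂ) (hz : z ≠ 0) :
    ∑ m ∈ Finset.Icc A B, f (m + r) * z ^ m = z ^ (-r) * ∑ m ∈ Finset.Icc p q, f m * z ^ m := by
  have e : ∑ m ∈ Finset.Icc p q, f m * z ^ m = ∑ m ∈ Finset.Icc (A + r) (B + r), f m * z ^ m := by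
    refine Finset.sum_subset (Finset.Icc_subset_Icc h1 h2) ?_
    intro m _ hm
    by_cases h : f m = 0
    · simp [h]
    · exact absurd (Finset.mem_Icc.2 (hf m h)) hm
  rw [e, Finset.mul_sum, ← Finset.map_add_right_Icc, Finset.sum_map]
  refine Finset.sum_congr rfl fun m _ => ?_
  simp only [addRightEmbedding_apply]
  rw [zpow_add₀ hz, zpow_neg]
  have := zpow_ne_zero r hz
  field_simp

section kernel
variable (M : ℕ)

/-- The Fejér coefficients. -/
noncomputable def a (k : ℤ) : ℝ := if 1 ≤ k ∧ k ≤ M then Real.sin (k * (π / (M + 1))) else 0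

noncomputable def c (j : ℤ) : ℝ := ∑ k ∈ Finset.Icc (1:ℤ) M, a M k * a M (k + j)

noncomputable def q (j : ℤ) : ℝ :=
  (c M (j + 1) + c M (j + (-1))) / 2 - Real.cos (π / (M + 1)) * c M (j + 0)

lemma a_pos (k : ℤ) (h : 1 ≤ k ∧ k ≤ M) : 0 < a M k := by
  unfold a
  rw [if_pos h]
  have h1 : (1:ℝ) ≤ k := by exact_mod_cast h.1
  have h2 : (k:ℝ) ≤ M := by exact_mod_cast h.2
  have hp := Real.pi_pos
  apply Real.sin_pos_of_pos_of_lt_pi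
  · positivity
  · rw [← mul_div_assoc, div_lt_iff₀ (by positivity)]
    nlinarith

lemma a_nonneg (k : ℤ) : 0 ≤ a M k := by
  by_cases h : 1 ≤ k ∧ k ≤ M
  · exact (a_pos M k h).le
  · simp [a, h]

lemma a_supp (k : ℤ) (h : a M k ≠ 0) : 1 ≤ k ∧ k ≤ M := by
  by_contra h'
  exact h (by simp [a, h'])

lemma a_eq (k : ℤ) (h : 0 ≤ k ∧ k ≤ M + 1) : a M k = Real.sin (k * (π / (M + 1))) := by
  unfold a
  split_ifs with h'
  · rfl
  · have : k = 0 ∨ k = M + 1 := by omega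
    rcases this with rfl | rfl
    · simp
    · push_cast
      rw [mul_div_cancel₀ _ (by positivity), Real.sin_pi]

lemma d_eq (m : ℤ) (h : 1 ≤ m ∧ m ≤ M) :
    a M (m + 1) + a M (m - 1) - 2 * Real.cos (π / (M + 1)) * a M m = 0 := by
  rw [a_eq M _ (by omega), a_eq M _ (by omega), a_eq M _ (by omega)]
  push_cast
  rw [add_mul, sub_mul, one_mul, Real.sin_add, Real.sin_sub]
  ring

lemma d_nonneg (m : ℤ) :
    0 ≤ a M (m + 1) + a M (m - 1) - 2 * Real.cos (π / (M + 1)) * a M m := by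
  by_cases h : 1 ≤ m ∧ m ≤ M
  · rw [d_eq M m h]
  · have : a M m = 0 := by simp [a, h]
    rw [this]
    have := a_nonneg M (m + 1)
    have := a_nonneg M (m - 1)
    linarith

lemma c_nonneg (j : ℤ) : 0 ≤ c M j :=
  Finset.sum_nonneg fun k _ => mul_nonneg (a_nonneg M _) (a_nonneg M _)

lemma q_eq (j : ℤ) : q M j = ∑ k ∈ Finset.Icc (1:ℤ) M, a M k *
    ((a M (k + j + 1) + a M (k + j - 1) - 2 * Real.cos (π / (M + 1)) * a M (k + j)) / 2) := by
  unfold q c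
  rw [← Finset.sum_add_distrib, Finset.sum_div, Finset.mul_sum, ← Finset.sum_sub_distrib]
  refine Finset.sum_congr rfl fun k _ => ?_
  rw [← add_assoc, ← add_assoc, add_zero, ← sub_eq_add_neg]
  ring

lemma q_nonneg (j : ℤ) : 0 ≤ q M j := by
  rw [q_eq]
  refine Finset.sum_nonneg fun k _ => mul_nonneg (a_nonneg M _) ?_
  have := d_nonneg M (k + j)
  linarith

lemma q_zero : q M 0 = 0 := by
  rw [q_eq]
  refine Finset.sum_eq_zero fun k hk => ?_
  rw [add_zero, d_eq M k (Finset.mem_Icc.1 hk)]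
  simp

lemma c_zero_pos (hM : 1 ≤ M) : 0 < c M 0 := by
  unfold c
  refine Finset.sum_pos (fun k hk => ?_) ⟨1, by simp; omega⟩
  rw [add_zero]
  have := a_pos M k (Finset.mem_Icc.1 hk)
  positivity

lemma c_supp (j : ℤ) (h : c M j ≠ 0) : -(M - 1 : ℤ) ≤ j ∧ j ≤ (M - 1 : ℤ) := by
  unfold c at h
  obtain ⟨k, hk, h2⟩ := Finset.exists_ne_zero_of_sum_ne_zero h
  have h3 := a_supp M _ (right_ne_zero_of_mul h2)
  rw [Finset.mem_Icc] at hk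
  omega

/-- the polynomial P -/
noncomputable def P (x : ℝ) : ℂ := ∑ m ∈ Finset.Icc (1:ℤ) M, (a M m : ℂ) * ee x ^ m

lemma ee_conj (x : ℝ) (m : ℤ) : (starRingEnd ℂ) (ee x ^ m) = ee x ^ (-m) := by
  rw [ee_zpow, ee_zpow]
  unfold ee
  rw [← Complex.exp_conj, map_mul, Complex.conj_ofReal, Complex.conj_I]
  congr 1
  push_cast
  ring

lemma c_sum (x : ℝ) : ∑ j ∈ Finset.Icc (-(M:ℤ)) M, (c M j : ℂ) * ee x ^ j
    = ((Complex.normSq (P M x) : ℝ) : ℂ) := by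
  have h1 : ∀ k ∈ Finset.Icc (1:ℤ) M,
      ∑ j ∈ Finset.Icc (-(M:ℤ)) M, (a M (j + k) : ℂ) * ee x ^ j = ee x ^ (-k) * P M x := by
    intro k hk
    rw [Finset.mem_Icc] at hk
    refine shift (fun m => (a M m : ℂ)) 1 M _ _ k ?_ (by omega) (by omega) _ (ee_ne x)
    intro m hm
    exact a_supp M m (by simpa using hm)
  unfold c
  push_cast
  simp_rw [Finset.sum_mul]
  rw [Finset.sum_comm]
  rw [← Complex.mul_conj, mul_comm]
  conv_rhs => rw [P, map_sum, Finset.sum_mul]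
  refine Finset.sum_congr rfl fun k hk => ?_
  rw [map_mul, ee_conj, Complex.conj_ofReal, mul_assoc, ← P, ← h1 k hk, Finset.mul_sum]
  refine Finset.sum_congr rfl fun j _ => ?_
  rw [add_comm k j]
  ring

lemma q_sum (x : ℝ) : ∑ j ∈ Finset.Icc (-(M:ℤ)) M, (q M j : ℂ) * ee x ^ j
    = ((Complex.normSq (P M x) * (Real.cos (2 * π * x) - Real.cos (π / (M + 1))) : ℝ) : ℂ) := by
  have h := fun (r : ℤ) (h1 : -1 ≤ r) (h2 : r ≤ 1) =>
    shift (fun m => (c M m : ℂ)) (-(M - 1 : ℤ)) (M - 1) (-M) M r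
      (fun m hm => c_supp M m (by simpa using hm)) (by omega) (by omega) (ee x) (ee_ne x)
  have h0 := h 0 (by norm_num) (by norm_num)
  have h1 := h 1 (by norm_num) (by norm_num)
  have h2 := h (-1) (by norm_num) (by norm_num)
  have h0' := h0
  simp only [add_zero, c_sum, neg_zero, zpow_zero, one_mul] at h0'
  rw [← h0'] at h0 h1 h2
  have e : ∀ j : ℤ, (q M j : ℂ) * ee x ^ j = ((c M (j + 1) : ℂ) * ee x ^ j +
      (c M (j + (-1)) : ℂ) * ee x ^ j) / 2
      - (Real.cos (π / (M + 1)) : ℂ) * ((c M (j + 0) : ℂ) * ee x ^ j) := by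
    intro j
    unfold q
    push_cast
    ring
  simp_rw [e]
  rw [Finset.sum_sub_distrib, ← Finset.sum_div, Finset.sum_add_distrib, ← Finset.mul_sum, h0, h1, h2]
  have hcos : ee x ^ (-1 : ℤ) + ee x ^ (- -1 : ℤ) = 2 * (Real.cos (2 * π * x) : ℂ) := by
    rw [ee_zpow, ee_zpow, Complex.ofReal_cos, Complex.cos]
    unfold ee
    push_cast
    ring_nf
  rw [← add_mul, hcos]
  push_cast
  simp
  ring

lemma ee_zero : ee 0 = 1 := by simp [ee]

lemma P_cont : Continuous (P M) := by
  unfold P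
  refine continuous_finsetSum _ fun m _ => continuous_const.mul ?_
  simp_rw [ee_zpow]
  exact ee_cont.comp (by fun_prop)

lemma c_tot : ∑ j ∈ Finset.Icc (-(M:ℤ)) M, c M j = Complex.normSq (P M 0) := by
  have := c_sum M 0
  simp only [ee_zero, one_zpow, mul_one] at this
  exact_mod_cast this

lemma q_tot : ∑ j ∈ Finset.Icc (-(M:ℤ)) M, q M j
    = Complex.normSq (P M 0) * (1 - Real.cos (π / (M + 1))) := by
  have := q_sum M 0
  simp only [ee_zero, one_zpow, mul_one, mul_zero, Real.cos_zero] at this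
  exact_mod_cast this

lemma tot_le : Complex.normSq (P M 0) ≤ M * c M 0 := by
  have : P M 0 = ((∑ m ∈ Finset.Icc (1:ℤ) M, a M m : ℝ) : ℂ) := by
    simp [P, ee_zero]
  rw [this, Complex.normSq_ofReal, ← sq]
  refine (sq_sum_le_card_mul_sum_sq).trans ?_
  simp [c, sq]

end kernel

lemma dist_le (y : ℝ) : |y - round y| ^ 2 ≤ 1 / 4 * Real.sin (π * y) ^ 2 := by
  have h1 := abs_sub_round y
  set w := |y - round y| with hw
  have hw0 : 0 ≤ w := abs_nonneg _
  have h2 : 2 * w ≤ Real.sin (π * w) := by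
    have := Real.mul_le_sin (x := π * w) (by positivity) (by nlinarith [Real.pi_pos])
    calc 2 * w = 2 / π * (π * w) := by field_simp
      _ ≤ _ := this
  have h3 : Real.sin (π * w) ^ 2 = Real.sin (π * y) ^ 2 := by
    have h4 : ∀ v : ℝ, Real.sin (π * v) ^ 2 = (1 - Real.cos (2 * π * v)) / 2 := by
      intro v
      rw [Real.sin_sq_eq_half_sub]
      ring_nf
    rw [h4, h4]
    have : Real.cos (2 * π * w) = Real.cos (2 * π * y) := by
      rw [← Real.cos_abs, abs_mul, hw, abs_abs, ← abs_mul, Real.cos_abs, mul_sub]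
      have := Real.cos_sub_int_mul_two_pi (2 * π * y) (round y)
      rw [← this]
      ring_nf
    rw [this]
  nlinarith

lemma final (N : ℕ) (lam η : Fin N → ℝ) (T₁ T₂ : ℝ) (hT : T₁ < T₂) (M : ℕ) (hM : 1 ≤ M)
    (L : ℝ) (hL : 0 < L)
    (hmin : ∀ u : Fin N → ℤ, (∀ n, |u n| ≤ (M : ℤ)) → u ≠ 0 → L ≤ |∑ n, (u n : ℝ) * lam n|)
    (hE : (M : ℝ) ^ N / (π * (T₂ - T₁) * L) ≤ 1 - Real.sin (π / (2 * (M + 1))) ^ 2) :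
    ∃ F : ℝ → ℝ, Continuous F ∧ (∀ t, 0 ≤ F t) ∧ 0 < ∫ t in T₁..T₂, F t ∧
      ∀ n, (∫ t in T₁..T₂, F t * Real.sin (π * (lam n * t - η n)) ^ 2) ≤
        (Real.sin (π / (2 * (M + 1))) ^ 2 + (M : ℝ) ^ N / (π * (T₂ - T₁) * L)) *
          ∫ t in T₁..T₂, F t := by
  classical
  set s2 := Real.sin (π / (2 * (M + 1))) ^ 2 with hs2
  set E := (M : ℝ) ^ N / (π * (T₂ - T₁) * L) with hEdef
  have hpi := Real.pi_pos
  have hTp : 0 < T₂ - T₁ := sub_pos.2 hT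
  have hMr : (1:ℝ) ≤ M := by exact_mod_cast hM
  have hs2pos : 0 < s2 := by
    have : 0 < Real.sin (π / (2 * (M + 1))) := by
      apply Real.sin_pos_of_pos_of_lt_pi
      · positivity
      · rw [div_lt_iff₀ (by positivity)]; nlinarith
    positivity
  have hcos : 1 - Real.cos (π / (M + 1)) = 2 * s2 := by
    rw [hs2, Real.sin_sq_eq_half_sub]
    have : 2 * (π / (2 * ((M:ℝ) + 1))) = π / (M + 1) := by field_simp
    rw [this]; ring
  have hEpos : 0 < E := by positivity
  have hc0 := c_zero_pos M hM
  set K := Complex.normSq (P M 0) with hK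
  have hK0 : 0 ≤ K := Complex.normSq_nonneg _
  have hKle : K ^ N ≤ (M:ℝ) ^ N * c M 0 ^ N := by
    rw [← mul_pow]
    exact pow_le_pow_left₀ hK0 (tot_le M) N
  have hKE : K ^ N / (π * L) ≤ c M 0 ^ N * (T₂ - T₁) * E := by
    rw [hEdef, div_le_iff₀ (by positivity)]
    have : c M 0 ^ N * (T₂ - T₁) * ((M : ℝ) ^ N / (π * (T₂ - T₁) * L)) * (π * L)
        = (M:ℝ) ^ N * c M 0 ^ N := by field_simp
    rw [this]; exact hKle
  set F : ℝ → ℝ := fun t => ∏ n, Complex.normSq (P M (lam n * t - η n)) with hF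
  have hFc : Continuous F := by
    refine continuous_finsetProd _ fun n _ => Complex.continuous_normSq.comp ?_
    exact (P_cont M).comp (by fun_prop)
  have hF0 : ∀ t, 0 ≤ F t := fun t => Finset.prod_nonneg fun n _ => Complex.normSq_nonneg _
  have hI1 : (T₂ - T₁) * c M 0 ^ N - c M 0 ^ N * (T₂ - T₁) * E ≤ ∫ t in T₁..T₂, F t := by
    have h := main_int N lam η T₁ T₂ M L hL hmin (fun _ => c M) (fun _ => c_nonneg M)
    simp only [c_sum, c_tot, ← Complex.ofReal_prod] at h
    rw [intervalIntegral.integral_ofReal, ← Complex.ofReal_sub, Complex.norm_real,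
      Real.norm_eq_abs] at h
    simp only [Finset.prod_const, Finset.card_univ, Fintype.card_fin] at h
    have h' := (abs_le.1 h).1
    have h2 : (K ^ N - c M 0 ^ N) / (π * L) ≤ K ^ N / (π * L) := by
      gcongr
      have : 0 < c M 0 ^ N := by positivity
      linarith
    linarith
  have hc0N : 0 < c M 0 ^ N * (T₂ - T₁) := by positivity
  refine ⟨F, hFc, hF0, ?_, ?_⟩
  · nlinarith
  intro n
  have hI2 : -(c M 0 ^ N * (T₂ - T₁) * E * (2 * s2)) ≤ ∫ t in T₁..T₂,
      F t * (Real.cos (2 * π * (lam n * t - η n)) - Real.cos (π / (M + 1))) := by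
    have h := main_int N lam η T₁ T₂ M L hL hmin (fun m => if m = n then q M else c M)
      (fun m j => by
        split_ifs
        · exact q_nonneg M j
        · exact c_nonneg M j)
    have e1 : ∀ (m : Fin N) (t : ℝ), ∑ j ∈ Finset.Icc (-(M:ℤ)) M,
        (((if m = n then q M else c M) j : ℝ) : ℂ) * ee (lam m * t - η m) ^ j =
        ((Complex.normSq (P M (lam m * t - η m)) *
          (if m = n then (Real.cos (2 * π * (lam m * t - η m)) - Real.cos (π / (M + 1)))
            else 1) : ℝ) : ℂ) := by
      intro m t
      split_ifs
      · rw [q_sum]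
      · rw [c_sum, mul_one]
    have e2 : ∀ (m : Fin N), ∑ j ∈ Finset.Icc (-(M:ℤ)) M, (if m = n then q M else c M) j =
        K * (if m = n then 2 * s2 else 1) := by
      intro m
      split_ifs
      · rw [q_tot, hcos]
      · rw [c_tot, mul_one]
    have e3 : ∏ m, (if m = n then q M else c M) 0 = 0 :=
      Finset.prod_eq_zero (Finset.mem_univ n) (by simp [q_zero])
    simp only [e1, e2, e3, ← Complex.ofReal_prod, Finset.prod_mul_distrib, Finset.prod_ite_eq',
      Finset.mem_univ, if_true] at h
    rw [intervalIntegral.integral_ofReal, ← Complex.ofReal_sub, Complex.norm_real,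
      Real.norm_eq_abs] at h
    simp only [Finset.prod_const, Finset.card_univ, Fintype.card_fin, mul_zero, sub_zero] at h
    have h' := (abs_le.1 h).1
    have h2 : K ^ N * (2 * s2) / (π * L) ≤ c M 0 ^ N * (T₂ - T₁) * E * (2 * s2) := by
      rw [mul_div_right_comm]
      gcongr
    linarith
  have e4 : ∀ t, F t * Real.sin (π * (lam n * t - η n)) ^ 2 = s2 * F t -
      1 / 2 * (F t * (Real.cos (2 * π * (lam n * t - η n)) - Real.cos (π / (M + 1)))) := by
    intro t
    rw [Real.sin_sq_eq_half_sub, ← mul_assoc]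
    have : Real.cos (π / (M + 1)) = 1 - 2 * s2 := by linarith
    rw [this]; ring
  simp_rw [e4]
  rw [intervalIntegral.integral_sub (Continuous.intervalIntegrable (by fun_prop) _ _)
    (Continuous.intervalIntegrable (by fun_prop) _ _), intervalIntegral.integral_const_mul,
    intervalIntegral.integral_const_mul]
  have : c M 0 ^ N * (T₂ - T₁) * E * s2 ≤ E * ∫ t in T₁..T₂, F t := by
    have h1 : c M 0 ^ N * (T₂ - T₁) * s2 ≤ ∫ t in T₁..T₂, F t := by nlinarith
    nlinarith
  linarith

end ChenAux

theorem stmt12 (N : ℕ) (lam ξ η : Fin N → ℝ)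
    (hind : ∀ u : Fin N → ℚ, (∑ n, (u n : ℝ) * lam n) = 0 → ∀ n, u n = 0)
    (hξ : ∀ n, 0 < ξ n) (T₁ T₂ : ℝ) (hT : T₁ < T₂) (M : ℕ) (hM : 1 ≤ M) (Λ : ℝ)
    (hΛ : Λ = sInf {x : ℝ | ∃ u : Fin N → ℤ, (∀ n, |u n| ≤ (M : ℤ)) ∧
      (∑ n, (u n : ℝ) * lam n) ≠ 0 ∧ x = |∑ n, (u n : ℝ) * lam n|}) :
    sInf {v : ℝ | ∃ t ∈ Set.Icc T₁ T₂,
        v = ∑ n, ξ n * |lam n * t - η n - round (lam n * t - η n)| ^ 2} ≤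
      1 / 4 * ∑ n, ξ n *
        (Real.sin (π / (2 * (M + 1))) ^ 2 + (M : ℝ) ^ N / (π * (T₂ - T₁) * Λ)) := by
  classical
  set A := {x : ℝ | ∃ u : Fin N → ℤ, (∀ n, |u n| ≤ (M : ℤ)) ∧
      (∑ n, (u n : ℝ) * lam n) ≠ 0 ∧ x = |∑ n, (u n : ℝ) * lam n|} with hA
  set V := {v : ℝ | ∃ t ∈ Set.Icc T₁ T₂,
        v = ∑ n, ξ n * |lam n * t - η n - round (lam n * t - η n)| ^ 2} with hV
  have hVb : BddBelow V := ⟨0, by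
    rintro v ⟨t, _, rfl⟩
    exact Finset.sum_nonneg fun n _ => mul_nonneg (hξ n).le (by positivity)⟩
  have hVle : ∀ t ∈ Set.Icc T₁ T₂, sInf V ≤
      1 / 4 * ∑ n, ξ n * Real.sin (π * (lam n * t - η n)) ^ 2 := by
    intro t ht
    refine (csInf_le hVb ⟨t, ht, rfl⟩).trans ?_
    rw [Finset.mul_sum]
    refine Finset.sum_le_sum fun n _ => ?_
    have := mul_le_mul_of_nonneg_left (ChenAux.dist_le (lam n * t - η n)) (hξ n).le
    linarith
  rcases Nat.eq_zero_or_pos N with rfl | hN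
  · have := hVle T₁ ⟨le_rfl, hT.le⟩
    simpa using this
  have hne : ∀ u : Fin N → ℤ, u ≠ 0 → (∑ n, (u n : ℝ) * lam n) ≠ 0 := by
    intro u hu h
    apply hu
    funext n
    have := hind (fun n => (u n : ℚ)) (by simpa using h) n
    simpa using this
  have hAb : BddBelow A := ⟨0, by
    rintro v ⟨u, _, _, rfl⟩
    exact abs_nonneg _⟩
  have hAfin : A.Finite := by
    refine Set.Finite.subset (Finset.finite_toSet
      ((Fintype.piFinset (fun _ : Fin N => Finset.Icc (-(M:ℤ)) M)).image
        (fun u => |∑ n, (u n : ℝ) * lam n|))) ?_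
    rintro v ⟨u, hu, _, rfl⟩
    rw [Finset.mem_coe, Finset.mem_image]
    exact ⟨u, Fintype.mem_piFinset.2 fun n => Finset.mem_Icc.2 (abs_le.1 (hu n)), rfl⟩
  have hAne : A.Nonempty := by
    refine ⟨_, fun _ => 1, fun n => ?_, hne _ ?_, rfl⟩
    · simp; omega
    · intro h
      have := congrFun h ⟨0, hN⟩
      simp at this
  have hΛpos : 0 < Λ := by
    rw [hΛ]
    obtain ⟨u, _, h, h2⟩ := hAne.csInf_mem hAfin
    rw [h2]
    exact abs_pos.2 h
  have hmin : ∀ u : Fin N → ℤ, (∀ n, |u n| ≤ (M : ℤ)) → u ≠ 0 →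
      Λ ≤ |∑ n, (u n : ℝ) * lam n| := by
    intro u hu hu0
    rw [hΛ]
    exact csInf_le hAb ⟨u, hu, hne u hu0, rfl⟩
  by_cases hE : (M : ℝ) ^ N / (π * (T₂ - T₁) * Λ) ≤ 1 - Real.sin (π / (2 * (M + 1))) ^ 2
  · obtain ⟨F, hFc, hF0, hFpos, hFn⟩ :=
      ChenAux.final N lam η T₁ T₂ hT M hM Λ hΛpos hmin hE
    set D := Real.sin (π / (2 * (M + 1))) ^ 2 + (M : ℝ) ^ N / (π * (T₂ - T₁) * Λ) with hD
    have h1 : (∫ t in T₁..T₂, F t * sInf V) ≤ ∫ t in T₁..T₂,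
        ∑ n, (1 / 4 * ξ n) * (F t * Real.sin (π * (lam n * t - η n)) ^ 2) := by
      refine intervalIntegral.integral_mono_on hT.le
        (Continuous.intervalIntegrable (by fun_prop) _ _)
        (Continuous.intervalIntegrable (by fun_prop) _ _) fun t ht => ?_
      refine (mul_le_mul_of_nonneg_left (hVle t ht) (hF0 t)).trans (le_of_eq ?_)
      rw [Finset.mul_sum, Finset.mul_sum]
      exact Finset.sum_congr rfl fun n _ => by ring
    rw [intervalIntegral.integral_finsetSum
      (fun u _ => Continuous.intervalIntegrable (by fun_prop) _ _),
      intervalIntegral.integral_mul_const] at h1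
    simp only [intervalIntegral.integral_const_mul] at h1
    have h2 : ∑ n, (1 / 4 * ξ n) * (∫ t in T₁..T₂, F t * Real.sin (π * (lam n * t - η n)) ^ 2)
        ≤ ∑ n, (1 / 4 * ξ n) * (D * ∫ t in T₁..T₂, F t) :=
      Finset.sum_le_sum fun n _ =>
        mul_le_mul_of_nonneg_left (hFn n) (by have := hξ n; positivity)
    have h3 : ∑ n, (1 / 4 * ξ n) * (D * ∫ t in T₁..T₂, F t)
        = (∫ t in T₁..T₂, F t) * (1 / 4 * ∑ n, ξ n * D) := by
      rw [Finset.mul_sum, Finset.mul_sum]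
      exact Finset.sum_congr rfl fun n _ => by ring
    exact le_of_mul_le_mul_left ((h1.trans h2).trans h3.le) hFpos
  · push Not at hE
    refine (hVle T₁ ⟨le_rfl, hT.le⟩).trans ?_
    refine mul_le_mul_of_nonneg_left (Finset.sum_le_sum fun n _ => ?_) (by norm_num)
    refine mul_le_mul_of_nonneg_left ?_ (hξ n).le
    have := Real.sin_sq_le_one (π * (lam n * T₁ - η n))
    linarith
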